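/- Purity concentration (Lemma 1): For any quantum state ρ^A (a density operator) on a system A of finite dimension d_A, the purity equals κ(ρ^A) = log d_A − H(A)_ρ, where H(A)_ρ = −Tr(ρ^A log ρ^A) is the von Neumann entropy of ρ^A. -/

import Mathlib

noncomputable section
namespace LPD

open Matrix Kronecker BigOperators Filter Finset
open scoped ComplexOrder

/-- The positive semidefinite square root of a positive semidefinite matrix
(Mathlib's former `Matrix.PosSemidef.sqrt`, with its old definition). -/
def _root_.Matrix.PosSemidef.sqrt {n 𝕜 : Type*} [Fintype n] [RCLike 𝕜] [DecidableEq n]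
    {A : Matrix n n 𝕜} (hA : A.PosSemidef) : Matrix n n 𝕜 :=
  hA.1.eigenvectorUnitary.1 * diagonal ((↑) ∘ Real.sqrt ∘ hA.1.eigenvalues) *
  (star hA.1.eigenvectorUnitary : Matrix n n 𝕜)

/-- The trace norm `‖ω‖₁ = Tr √(ωᴴ ω)` of a matrix. -/
def traceNorm {ι : Type*} [Fintype ι] [DecidableEq ι] (ω : Matrix ι ι ℂ) : ℝ :=
  ((Matrix.posSemidef_conjTranspose_mul_self ω).sqrt).trace.re

/-- A density operator: positive semidefinite with trace one. -/
def IsDensity {ι : Type*} [Fintype ι] (ρ : Matrix ι ι ℂ) : Prop :=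
  ρ.PosSemidef ∧ ρ.trace = 1

/-- The von Neumann entropy `H(ρ) = -Tr(ρ log ρ)`, expressed via eigenvalues
(with the convention `0 log 0 = 0`, and junk value `0` on non-Hermitian input). -/
def entropy {ι : Type*} [Fintype ι] [DecidableEq ι] (ρ : Matrix ι ι ℂ) : ℝ :=
  letI := Classical.dec ρ.IsHermitian
  if h : ρ.IsHermitian then -∑ i, h.eigenvalues i * Real.log (h.eigenvalues i) else 0

/-- Partial trace over the first (left) tensor factor. -/
def ptraceLeft {α β : Type*} [Fintype α] (ρ : Matrix (α × β) (α × β) ℂ) : Matrix β β ℂ :=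
  fun b b' => ∑ a, ρ (a, b) (a, b')

/-- Partial trace over the second (right) tensor factor. -/
def ptraceRight {α β : Type*} [Fintype β] (ρ : Matrix (α × β) (α × β) ℂ) : Matrix α α ℂ :=
  fun a a' => ∑ b, ρ (a, b) (a', b)

/-- Quantum mutual information `I(A;B) = H(A) + H(B) - H(AB)` of a bipartite state. -/
def mutualInfo {α β : Type*} [Fintype α] [DecidableEq α] [Fintype β] [DecidableEq β]
    (ρ : Matrix (α × β) (α × β) ℂ) : ℝ :=
  entropy (ptraceRight ρ) + entropy (ptraceLeft ρ) - entropy ρ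

/-- Conditional entropy `H(B|A) = H(AB) - H(A)` (second system conditioned on the first). -/
def condEntropySnd {α β : Type*} [Fintype α] [DecidableEq α] [Fintype β] [DecidableEq β]
    (ρ : Matrix (α × β) (α × β) ℂ) : ℝ :=
  entropy ρ - entropy (ptraceRight ρ)

/-- Conditional entropy `H(A|B) = H(AB) - H(B)` (first system conditioned on the second). -/
def condEntropyFst {α β : Type*} [Fintype α] [DecidableEq α] [Fintype β] [DecidableEq β]
    (ρ : Matrix (α × β) (α × β) ℂ) : ℝ :=
  entropy ρ - entropy (ptraceLeft ρ)

/-- `n`-fold tensor power of a matrix. -/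
def tpow {ι : Type*} (ρ : Matrix ι ι ℂ) (n : ℕ) : Matrix (Fin n → ι) (Fin n → ι) ℂ :=
  fun x y => ∏ k, ρ (x k) (y k)

/-- `n`-fold tensor power of a bipartite state, with the `A` and `B` factors collected. -/
def tpowAB {α β : Type*} (ρ : Matrix (α × β) (α × β) ℂ) (n : ℕ) :
    Matrix ((Fin n → α) × (Fin n → β)) ((Fin n → α) × (Fin n → β)) ℂ :=
  Matrix.reindex (Equiv.arrowProdEquivProdArrow (Fin n) (fun _ => α) (fun _ => β))
    (Equiv.arrowProdEquivProdArrow (Fin n) (fun _ => α) (fun _ => β)) (tpow ρ n)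

/-- A POVM on the system `ι` with outcome set `κ`. -/
structure POVM (ι κ : Type*) [Fintype ι] [DecidableEq ι] [Fintype κ] where
  elem : κ → Matrix ι ι ℂ
  pos : ∀ y, (elem y).PosSemidef
  sum_eq : ∑ y, elem y = 1

/-- Apply a POVM to the first factor of a bipartite state, recording the outcome in a
classical register: `ρ^{AΓ} ↦ Σ_y |y⟩⟨y| ⊗ Tr_A((Λ_y ⊗ 1)ρ)`. -/
def measureLeft {ι κ γ : Type*} [Fintype ι] [DecidableEq ι] [Fintype κ] [DecidableEq κ]
    (Λ : POVM ι κ) (ρ : Matrix (ι × γ) (ι × γ) ℂ) : Matrix (κ × γ) (κ × γ) ℂ :=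
  fun p q => if p.1 = q.1 then ∑ a, ∑ a', (Λ.elem p.1) a a' * ρ (a', p.2) (a, q.2) else 0

/-- The canonical purification of a density operator `ρ` on `ι`, a pure state on `ι × ι`
(junk value `0` for non-positive-semidefinite input). -/
def canonicalPurification {ι : Type*} [Fintype ι] [DecidableEq ι] (ρ : Matrix ι ι ℂ) :
    Matrix (ι × ι) (ι × ι) ℂ :=
  letI := Classical.dec ρ.PosSemidef
  if h : ρ.PosSemidef then
    vecMulVec (fun p => h.sqrt p.1 p.2) (star fun p => h.sqrt p.1 p.2)
  else 0

/-- The purity `κ(ρ) = log d - H(ρ)`. -/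
def kappa {ι : Type*} [Fintype ι] [DecidableEq ι] (ρ : Matrix ι ι ℂ) : ℝ :=
  Real.log (Fintype.card ι) - entropy ρ

/-- The pure state `|0⟩⟨0|` on a `d`-dimensional system. -/
def pureZero (d : ℕ) : Matrix (Fin d) (Fin d) ℂ :=
  fun i j => if i.val = 0 ∧ j.val = 0 then 1 else 0

/-! ### Index bookkeeping equivalences -/

/-- `(a × b) × c ≃ (a × c) × b`. -/
def swapE (a b c : Type*) : (a × b) × c ≃ (a × c) × b where
  toFun x := ((x.1.1, x.2), x.1.2)
  invFun x := ((x.1.1, x.2), x.1.2)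
  left_inv _ := rfl
  right_inv _ := rfl

/-- Pull the `Y` register to the front: `((a × y) × g) × b ≃ y × ((a × g) × b)`. -/
def pullY (a y g b : Type*) : ((a × y) × g) × b ≃ y × ((a × g) × b) where
  toFun x := (x.1.1.2, ((x.1.1.1, x.1.2), x.2))
  invFun x := (((x.2.1.1, x.1), x.2.1.2), x.2.2)
  left_inv _ := rfl
  right_inv _ := rfl

/-- Rearrange for Bob's unitary: `((a × y) × g) × b ≃ (b × y) × (a × g)`. -/
def pullBY (a y g b : Type*) : ((a × y) × g) × b ≃ (b × y) × (a × g) where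
  toFun x := ((x.2, x.1.1.2), (x.1.1.1, x.1.2))
  invFun x := (((x.2.1, x.1.2), x.2.2), x.1.1)
  left_inv _ := rfl
  right_inv _ := rfl

/-- Collect `Y` and `B` together: `((a × y) × g) × b ≃ (y × b) × (a × g)`. -/
def pullYB (a y g b : Type*) : ((a × y) × g) × b ≃ (y × b) × (a × g) where
  toFun x := ((x.1.1.2, x.2), (x.1.1.1, x.1.2))
  invFun x := (((x.2.1, x.1.1), x.2.2), x.1.2)
  left_inv _ := rfl
  right_inv _ := rfl

/-- Sort output registers: `(bp × bg) × (ap × ag) ≃ (ap × bp) × (ag × bg)`. -/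
def sortOut (bp bg ap ag : Type*) : (bp × bg) × (ap × ag) ≃ (ap × bp) × (ag × bg) where
  toFun x := ((x.2.1, x.1.1), (x.2.2, x.1.2))
  invFun x := ((x.1.2, x.2.2), (x.1.1, x.2.1))
  left_inv _ := rfl
  right_inv _ := rfl

/-- `y × (x × w) ≃ (y × w) × x`. -/
def exYW (y x w : Type*) : y × (x × w) ≃ (y × w) × x where
  toFun a := ((a.1, a.2.2), a.2.1)
  invFun a := (a.1.1, (a.2, a.1.2))
  left_inv _ := rfl
  right_inv _ := rfl

/-- `y × (x × w) ≃ (y × x) × w`. -/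
def exYX (y x w : Type*) : y × (x × w) ≃ (y × x) × w where
  toFun a := ((a.1, a.2.1), a.2.2)
  invFun a := (a.1.1, (a.1.2, a.2))
  left_inv _ := rfl
  right_inv _ := rfl

/-- `y × (x × (b × e)) ≃ (y × b) × (x × e)`. -/
def exYB (y x b e : Type*) : y × (x × (b × e)) ≃ (y × b) × (x × e) where
  toFun a := ((a.1, a.2.2.1), (a.2.1, a.2.2.2))
  invFun a := (a.1.1, (a.2.1, (a.1.2, a.2.2)))
  left_inv _ := rfl
  right_inv _ := rfl

/-! ### The state `σ^{YBE}` obtained by measuring Alice's share of a purification -/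

/-- The canonical purification of a bipartite state `ρ^{AB}`, with indices arranged as
`A × (B × E)` where `E = A × B`. -/
def purifyAssoc {α β : Type*} [Fintype α] [DecidableEq α] [Fintype β] [DecidableEq β]
    (ρ : Matrix (α × β) (α × β) ℂ) :
    Matrix (α × (β × (α × β))) (α × (β × (α × β))) ℂ :=
  Matrix.reindex (Equiv.prodAssoc α β (α × β)) (Equiv.prodAssoc α β (α × β))
    (canonicalPurification ρ)

/-- `σ^{YBE} = (Λ ⊗ 1^{BE})(Ψ^{ABE})` for the canonical purification `Ψ` of `ρ^{AB}`. -/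
def sigmaOf {α β κ : Type*} [Fintype α] [DecidableEq α] [Fintype β] [DecidableEq β]
    [Fintype κ] [DecidableEq κ] (ρ : Matrix (α × β) (α × β) ℂ) (Λ : POVM α κ) :
    Matrix (κ × (β × (α × β))) (κ × (β × (α × β))) ℂ :=
  measureLeft Λ (purifyAssoc ρ)

/-- `I(Y;B)` evaluated on a state of the form `σ^{Y(BE)}`: trace out `E`, then take the
mutual information. -/
def IYB {κ β ε : Type*} [Fintype κ] [DecidableEq κ] [Fintype β] [DecidableEq β] [Fintype ε]
    (σ : Matrix (κ × (β × ε)) (κ × (β × ε)) ℂ) : ℝ :=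
  mutualInfo (ptraceRight (Matrix.reindex (Equiv.prodAssoc κ β ε).symm
    (Equiv.prodAssoc κ β ε).symm σ))

/-- `I(Y;BE)` evaluated on a state of the form `σ^{Y(BE)}`. -/
def IYBE {κ β ε : Type*} [Fintype κ] [DecidableEq κ] [Fintype β] [DecidableEq β] [Fintype ε]
    [DecidableEq ε] (σ : Matrix (κ × (β × ε)) (κ × (β × ε)) ℂ) : ℝ :=
  mutualInfo σ

/-- `P^{(1)}_→(ρ^{AB}, R) = max_Λ { I(Y;B)_σ : I(Y;BE)_σ ≤ R }`, the maximum over all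
POVMs on Alice's system. -/
def P1 {α β : Type*} [Fintype α] [DecidableEq α] [Fintype β] [DecidableEq β]
    (ρ : Matrix (α × β) (α × β) ℂ) (R : ℝ) : ℝ :=
  sSup { v : ℝ | ∃ (m : ℕ) (Λ : POVM α (Fin m)),
    IYBE (sigmaOf ρ Λ) ≤ R ∧ v = IYB (sigmaOf ρ Λ) }

/-! ### Local purity distillation protocols -/

/-- An `(n, ·, ·, ·)` local purity distillation protocol: Alice's unitary
`U_A : H_{A^n} ⊗ H_C → H_{A_p} ⊗ H_Y ⊗ H_{A_g}`, a dephasing channel on `Y`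
(applied below), and Bob's unitary `U_B : H_{B^n} ⊗ H_Y → H_{B_p} ⊗ H_{B_g}`. -/
structure Protocol (α β : Type*) [Fintype α] [DecidableEq α] [Fintype β] [DecidableEq β]
    (n : ℕ) where
  dC : ℕ
  dAp : ℕ
  dY : ℕ
  dAg : ℕ
  dBp : ℕ
  dBg : ℕ
  dC_pos : 0 < dC
  dAp_pos : 0 < dAp
  dY_pos : 0 < dY
  dAg_pos : 0 < dAg
  dBp_pos : 0 < dBp
  dBg_pos : 0 < dBg
  UA : Matrix ((Fin dAp × Fin dY) × Fin dAg) ((Fin n → α) × Fin dC) ℂ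
  UA_unitary : UAᴴ * UA = 1 ∧ UA * UAᴴ = 1
  UB : Matrix (Fin dBp × Fin dBg) ((Fin n → β) × Fin dY) ℂ
  UB_unitary : UBᴴ * UB = 1 ∧ UB * UBᴴ = 1

variable {α β : Type*} [Fintype α] [DecidableEq α] [Fintype β] [DecidableEq β]

/-- The input state `(ρ^{AB})^{⊗n} ⊗ |0⟩⟨0|^C`, arranged as `(A^n × C) × B^n`. -/
def inputState (ρ : Matrix (α × β) (α × β) ℂ) {n : ℕ} (Pr : Protocol α β n) :
    Matrix (((Fin n → α) × Fin Pr.dC) × (Fin n → β))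
      (((Fin n → α) × Fin Pr.dC) × (Fin n → β)) ℂ :=
  Matrix.reindex (swapE (Fin n → α) (Fin n → β) (Fin Pr.dC))
    (swapE (Fin n → α) (Fin n → β) (Fin Pr.dC)) (tpowAB ρ n ⊗ₖ pureZero Pr.dC)

/-- The state `U_A((ρ^{AB})^{⊗n} ⊗ |0⟩⟨0|^C)` (before dephasing), on
`((A_p × Y) × A_g) × B^n`. -/
def stateAfterUA (ρ : Matrix (α × β) (α × β) ℂ) {n : ℕ} (Pr : Protocol α β n) :
    Matrix (((Fin Pr.dAp × Fin Pr.dY) × Fin Pr.dAg) × (Fin n → β))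
      (((Fin Pr.dAp × Fin Pr.dY) × Fin Pr.dAg) × (Fin n → β)) ℂ :=
  (Pr.UA ⊗ₖ (1 : Matrix (Fin n → β) (Fin n → β) ℂ)) * inputState ρ Pr *
    (Pr.UA ⊗ₖ (1 : Matrix (Fin n → β) (Fin n → β) ℂ))ᴴ

/-- Dephase the first tensor factor in a fixed basis. -/
def dephaseFst {κ γ : Type*} [DecidableEq κ] (ρ : Matrix (κ × γ) (κ × γ) ℂ) :
    Matrix (κ × γ) (κ × γ) ℂ :=
  fun p q => if p.1 = q.1 then ρ p q else 0

/-- The state after Alice's unitary and the dephasing channel on `Y`. -/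
def stateAfterDephasing (ρ : Matrix (α × β) (α × β) ℂ) {n : ℕ} (Pr : Protocol α β n) :
    Matrix (((Fin Pr.dAp × Fin Pr.dY) × Fin Pr.dAg) × (Fin n → β))
      (((Fin Pr.dAp × Fin Pr.dY) × Fin Pr.dAg) × (Fin n → β)) ℂ :=
  Matrix.reindex (pullY (Fin Pr.dAp) (Fin Pr.dY) (Fin Pr.dAg) (Fin n → β)).symm
    (pullY (Fin Pr.dAp) (Fin Pr.dY) (Fin Pr.dAg) (Fin n → β)).symm
    (dephaseFst (Matrix.reindex (pullY (Fin Pr.dAp) (Fin Pr.dY) (Fin Pr.dAg) (Fin n → β))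
      (pullY (Fin Pr.dAp) (Fin Pr.dY) (Fin Pr.dAg) (Fin n → β)) (stateAfterUA ρ Pr)))

/-- The final state `Υ`, after Bob's unitary, on `(B_p × B_g) × (A_p × A_g)`. -/
def stateAfterUB (ρ : Matrix (α × β) (α × β) ℂ) {n : ℕ} (Pr : Protocol α β n) :
    Matrix ((Fin Pr.dBp × Fin Pr.dBg) × (Fin Pr.dAp × Fin Pr.dAg))
      ((Fin Pr.dBp × Fin Pr.dBg) × (Fin Pr.dAp × Fin Pr.dAg)) ℂ :=
  (Pr.UB ⊗ₖ (1 : Matrix (Fin Pr.dAp × Fin Pr.dAg) (Fin Pr.dAp × Fin Pr.dAg) ℂ)) *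
    Matrix.reindex (pullBY (Fin Pr.dAp) (Fin Pr.dY) (Fin Pr.dAg) (Fin n → β))
      (pullBY (Fin Pr.dAp) (Fin Pr.dY) (Fin Pr.dAg) (Fin n → β)) (stateAfterDephasing ρ Pr) *
    (Pr.UB ⊗ₖ (1 : Matrix (Fin Pr.dAp × Fin Pr.dAg) (Fin Pr.dAp × Fin Pr.dAg) ℂ))ᴴ

/-- The reduced output state `Υ^{A_p B_p}`. -/
def outputReduced (ρ : Matrix (α × β) (α × β) ℂ) {n : ℕ} (Pr : Protocol α β n) :
    Matrix (Fin Pr.dAp × Fin Pr.dBp) (Fin Pr.dAp × Fin Pr.dBp) ℂ :=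
  ptraceRight (Matrix.reindex
    (sortOut (Fin Pr.dBp) (Fin Pr.dBg) (Fin Pr.dAp) (Fin Pr.dAg))
    (sortOut (Fin Pr.dBp) (Fin Pr.dBg) (Fin Pr.dAp) (Fin Pr.dAg)) (stateAfterUB ρ Pr))

/-- The error of a protocol: trace distance of `Υ^{A_p B_p}` from `|0⟩⟨0| ⊗ |0⟩⟨0|`. -/
def protocolError (ρ : Matrix (α × β) (α × β) ℂ) {n : ℕ} (Pr : Protocol α β n) : ℝ :=
  traceNorm (outputReduced ρ Pr - pureZero Pr.dAp ⊗ₖ pureZero Pr.dBp)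

/-- The classical communication rate `(1/n) log d_Y` of a protocol. -/
def commRate {n : ℕ} (Pr : Protocol α β n) : ℝ := Real.log Pr.dY / n

/-- The purity rate `(1/n)(log d_{A_p}d_{B_p} - log d_C)` of a protocol. -/
def purityRate {n : ℕ} (Pr : Protocol α β n) : ℝ :=
  (Real.log (Pr.dAp * Pr.dBp) - Real.log Pr.dC) / n

/-- Achievability of a rate pair `(P, R)`: for all `ε, δ > 0` and all sufficiently large `n`
there is an `(n, R+δ, P-δ, ε)` protocol. -/
def Achievable (ρ : Matrix (α × β) (α × β) ℂ) (P R : ℝ) : Prop :=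
  ∀ ε > (0 : ℝ), ∀ δ > (0 : ℝ), ∃ N : ℕ, ∀ n ≥ N, ∃ Pr : Protocol α β n,
    commRate Pr ≤ R + δ ∧ P - δ ≤ purityRate Pr ∧ protocolError ρ Pr ≤ ε

/-- The 1-way distillable local purity `κ_→(ρ^{AB}, R)`. -/
def kappaArrow (ρ : Matrix (α × β) (α × β) ℂ) (R : ℝ) : ℝ :=
  sSup { P : ℝ | Achievable ρ P R }

/-- `I(Y;B^n)` on the pre-dephasing state `U_A((ρ^{AB})^{⊗n} ⊗ |0⟩⟨0|^C)`. -/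
def preDephIYB (ρ : Matrix (α × β) (α × β) ℂ) {n : ℕ} (Pr : Protocol α β n) : ℝ :=
  mutualInfo (ptraceRight (Matrix.reindex
    (pullYB (Fin Pr.dAp) (Fin Pr.dY) (Fin Pr.dAg) (Fin n → β))
    (pullYB (Fin Pr.dAp) (Fin Pr.dY) (Fin Pr.dAg) (Fin n → β)) (stateAfterUA ρ Pr)))

/-- The pre-dephasing state together with the purifying environment `E^n`:
`(U_A ⊗ 1^{B^nE^n})((Ψ^{ABE})^{⊗n} ⊗ |0⟩⟨0|^C)`, where `Ψ` is the canonical purification. -/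
def preDephWithEnv (ρ : Matrix (α × β) (α × β) ℂ) {n : ℕ} (Pr : Protocol α β n) :
    Matrix (((Fin Pr.dAp × Fin Pr.dY) × Fin Pr.dAg) × (Fin n → β × (α × β)))
      (((Fin Pr.dAp × Fin Pr.dY) × Fin Pr.dAg) × (Fin n → β × (α × β))) ℂ :=
  (Pr.UA ⊗ₖ (1 : Matrix (Fin n → β × (α × β)) (Fin n → β × (α × β)) ℂ)) *
    Matrix.reindex (swapE (Fin n → α) (Fin n → β × (α × β)) (Fin Pr.dC))
      (swapE (Fin n → α) (Fin n → β × (α × β)) (Fin Pr.dC))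
      (tpowAB (purifyAssoc ρ) n ⊗ₖ pureZero Pr.dC) *
    (Pr.UA ⊗ₖ (1 : Matrix (Fin n → β × (α × β)) (Fin n → β × (α × β)) ℂ))ᴴ

/-- `I(Y;B^nE^n)` on the pre-dephasing state, including the purifying environment. -/
def preDephIYBE (ρ : Matrix (α × β) (α × β) ℂ) {n : ℕ} (Pr : Protocol α β n) : ℝ :=
  mutualInfo (ptraceRight (Matrix.reindex
    (pullYB (Fin Pr.dAp) (Fin Pr.dY) (Fin Pr.dAg) (Fin n → β × (α × β)))
    (pullYB (Fin Pr.dAp) (Fin Pr.dY) (Fin Pr.dAg) (Fin n → β × (α × β)))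
    (preDephWithEnv ρ Pr)))

/-- `H(Y)` on the pre-dephasing state. -/
def preDephHY (ρ : Matrix (α × β) (α × β) ℂ) {n : ℕ} (Pr : Protocol α β n) : ℝ :=
  entropy (ptraceRight (Matrix.reindex
    (pullY (Fin Pr.dAp) (Fin Pr.dY) (Fin Pr.dAg) (Fin n → β))
    (pullY (Fin Pr.dAp) (Fin Pr.dY) (Fin Pr.dAg) (Fin n → β)) (stateAfterUA ρ Pr)))

/-! ### Single-party purity concentration -/

/-- An `(n, ·, ·)` purity concentration protocol: a unitary
`U : H_{A^n} → H_{A_p} ⊗ H_{A_g}`. -/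
structure ConcProtocol (α : Type*) [Fintype α] [DecidableEq α] (n : ℕ) where
  dAp : ℕ
  dAg : ℕ
  dAp_pos : 0 < dAp
  dAg_pos : 0 < dAg
  U : Matrix (Fin dAp × Fin dAg) (Fin n → α) ℂ
  U_unitary : Uᴴ * U = 1 ∧ U * Uᴴ = 1

/-- The reduced state `Υ^{A_p}` of `U ρ^{⊗n} U†`. -/
def concOutput {α : Type*} [Fintype α] [DecidableEq α] (ρ : Matrix α α ℂ) {n : ℕ}
    (Pr : ConcProtocol α n) : Matrix (Fin Pr.dAp) (Fin Pr.dAp) ℂ :=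
  ptraceRight (Pr.U * tpow ρ n * Pr.Uᴴ)

/-- Achievability of a purity-concentration rate `P`. -/
def ConcAchievable {α : Type*} [Fintype α] [DecidableEq α] (ρ : Matrix α α ℂ) (P : ℝ) :
    Prop :=
  ∀ ε > (0 : ℝ), ∀ δ > (0 : ℝ), ∃ N : ℕ, ∀ n ≥ N, ∃ Pr : ConcProtocol α n,
    P - δ ≤ Real.log Pr.dAp / n ∧ traceNorm (concOutput ρ Pr - pureZero Pr.dAp) ≤ ε

/-- The purity `κ(ρ)`: the supremum of all achievable concentration rates. -/
def kappaConc {α : Type*} [Fintype α] [DecidableEq α] (ρ : Matrix α α ℂ) : ℝ :=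
  sSup { P : ℝ | ConcAchievable ρ P }

/-! ### Measurement compression -/

/-- The averaged compressed-measurement map
`σ ↦ (1/|L|) Σ_l Σ_m Tr(Λ̃^{(l)}_m σ) |f(m,l)⟩⟨f(m,l)|`, applied to the first factor. -/
def mcMap {A Ω γ' : Type*} [Fintype A] [DecidableEq A] [Fintype Ω] [DecidableEq Ω]
    (L M : ℕ) (Λt : Fin L → POVM A (Fin M)) (f : Fin M → Fin L → Ω)
    (ρ : Matrix (A × γ') (A × γ') ℂ) : Matrix (Ω × γ') (Ω × γ') ℂ :=
  fun p q => (L : ℂ)⁻¹ * ∑ l, ∑ m, (if f m l = p.1 ∧ f m l = q.1 then 1 else 0) *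
    ∑ a, ∑ a', ((Λt l).elem m) a a' * ρ (a', p.2) (a, q.2)

/-! ### Classical-quantum states and classical channels -/

/-- The classical-quantum state `Σ_x p(x) |x⟩⟨x| ⊗ ρ_x`. -/
def cqState {𝒳 B : Type*} [DecidableEq 𝒳] (p : 𝒳 → ℝ) (ρx : 𝒳 → Matrix B B ℂ) :
    Matrix (𝒳 × B) (𝒳 × B) ℂ :=
  fun P Q => if P.1 = Q.1 then (p P.1 : ℂ) * ρx P.1 P.2 Q.2 else 0

/-- The state on `Y × (X × W)` obtained from a purification vector `ψ` of a cq state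
(with classical system `X` and the rest `W`) by applying a classical channel `q(y|x)`
to the classical system: `Σ_{x,y} q(y|x) |y⟩⟨y| ⊗ |x⟩⟨x|-block of p(x)·(BE state given x)`. -/
def chanState {𝒳 W 𝒴 : Type*} [DecidableEq 𝒳] [DecidableEq 𝒴]
    (ψ : 𝒳 × W → ℂ) (q : 𝒳 → 𝒴 → ℝ) :
    Matrix (𝒴 × (𝒳 × W)) (𝒴 × (𝒳 × W)) ℂ :=
  fun P Q => if P.1 = Q.1 ∧ P.2.1 = Q.2.1
    then (q P.2.1 P.1 : ℂ) * ψ P.2 * star (ψ Q.2) else 0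

/-- The `n`-fold tensor power of a purification vector of a cq state, with the
classical, `B` and `E` registers collected. -/
def vecPowBE {𝒳 B E : Type*} (ψ : 𝒳 × (B × E) → ℂ) (n : ℕ) :
    (Fin n → 𝒳) × ((Fin n → B) × (Fin n → E)) → ℂ :=
  fun xw => ∏ k, ψ (xw.1 k, (xw.2.1 k, xw.2.2 k))

variable {𝒴' 𝒳 B E : Type*} [Fintype 𝒴'] [DecidableEq 𝒴'] [Fintype 𝒳] [DecidableEq 𝒳]
  [Fintype B] [DecidableEq B] [Fintype E] [DecidableEq E]

/-- `I(Y;B)` on a state of the form `τ^{Y(X(BE))}`. -/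
def miYB (τ : Matrix (𝒴' × (𝒳 × (B × E))) (𝒴' × (𝒳 × (B × E))) ℂ) : ℝ :=
  mutualInfo (ptraceRight (Matrix.reindex (exYB 𝒴' 𝒳 B E) (exYB 𝒴' 𝒳 B E) τ))

/-- `I(Y;BE)` on a state of the form `τ^{Y(X(BE))}`. -/
def miYBE (τ : Matrix (𝒴' × (𝒳 × (B × E))) (𝒴' × (𝒳 × (B × E))) ℂ) : ℝ :=
  mutualInfo (ptraceRight (Matrix.reindex (exYW 𝒴' 𝒳 (B × E)) (exYW 𝒴' 𝒳 (B × E)) τ))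

/-- `I(Y;X)` on a state of the form `τ^{Y(X(BE))}`. -/
def miYX (τ : Matrix (𝒴' × (𝒳 × (B × E))) (𝒴' × (𝒳 × (B × E))) ℂ) : ℝ :=
  mutualInfo (ptraceRight (Matrix.reindex (exYX 𝒴' 𝒳 (B × E)) (exYX 𝒴' 𝒳 (B × E)) τ))

/-- A classical channel: entrywise nonnegative with rows summing to one. -/
def IsChannel {X Y : Type*} [Fintype Y] (q : X → Y → ℝ) : Prop :=
  (∀ x y, 0 ≤ q x y) ∧ ∀ x, ∑ y, q x y = 1

/-- `P_n(R) = max_{Y|X^n} { (1/n) I(Y;B^n) : (1/n) I(Y;B^nE^n) ≤ R }` for a cq state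
with purification vector `ψ`. -/
def Pn (ψ : 𝒳 × (B × E) → ℂ) (n : ℕ) (R : ℝ) : ℝ :=
  sSup { v : ℝ | ∃ (m : ℕ) (q : (Fin n → 𝒳) → Fin m → ℝ), IsChannel q ∧
    (1 / n : ℝ) * miYBE (chanState (vecPowBE ψ n) q) ≤ R ∧
    v = (1 / n : ℝ) * miYB (chanState (vecPowBE ψ n) q) }

/-- `D_n(R) = max_{Y|X^n} { (1/n) I(Y;B^n) : (1/n)(I(Y;X^n) - I(Y;B^n)) ≤ R }` for a cq
state with purification vector `ψ`. -/
def Dn (ψ : 𝒳 × (B × E) → ℂ) (n : ℕ) (R : ℝ) : ℝ :=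
  sSup { v : ℝ | ∃ (m : ℕ) (q : (Fin n → 𝒳) → Fin m → ℝ), IsChannel q ∧
    (1 / n : ℝ) * (miYX (chanState (vecPowBE ψ n) q)
      - miYB (chanState (vecPowBE ψ n) q)) ≤ R ∧
    v = (1 / n : ℝ) * miYB (chanState (vecPowBE ψ n) q) }

/-! ### Quantum channels -/

/-- A completely positive trace-preserving map between matrix algebras. -/
structure CPTP (ι κ : Type*) [Fintype ι] [DecidableEq ι] [Fintype κ] [DecidableEq κ] where
  map : Matrix ι ι ℂ →ₗ[ℂ] Matrix κ κ ℂ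
  trace_preserving : ∀ ρ, (map ρ).trace = ρ.trace
  completely_positive : ∀ (n : ℕ) (ρ : Matrix (ι × Fin n) (ι × Fin n) ℂ), ρ.PosSemidef →
    (Matrix.of fun p q : κ × Fin n =>
      map (Matrix.of fun i i' => ρ (i, p.2) (i', q.2)) p.1 q.1).PosSemidef


/-! ### Helpers: classical typicality -/

theorem hp_sum_cons {ι : Type*} [Fintype ι] {n : ℕ} (F : (Fin (n+1) → ι) → ℝ) :
    ∑ x, F x = ∑ a, ∑ y : Fin n → ι, F (Fin.cons a y) := by
  rw [← Fintype.sum_prod_type']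
  exact (Fintype.sum_equiv (Fin.consEquiv (fun _ => ι)) _ _ (fun _ => rfl)).symm

theorem hp_mom0 {ι : Type*} [Fintype ι] (p : ι → ℝ) (hp : ∑ a, p a = 1) (n : ℕ) :
    ∑ x : Fin n → ι, ∏ k, p (x k) = 1 := by
  induction n with
  | zero => simp
  | succ n ih =>
    rw [hp_sum_cons]
    simp [Fin.prod_univ_succ, ← Finset.mul_sum, ih, hp]

theorem hp_mom1 {ι : Type*} [Fintype ι] (p g : ι → ℝ) (hp : ∑ a, p a = 1)
    (hg : ∑ a, p a * g a = 0) (n : ℕ) :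
    ∑ x : Fin n → ι, (∏ k, p (x k)) * ∑ k, g (x k) = 0 := by
  induction n with
  | zero => simp
  | succ n ih =>
    rw [hp_sum_cons]
    have h0 := hp_mom0 p hp n
    calc _ = ∑ a, (p a * g a * ∑ y : Fin n → ι, ∏ k, p (y k)
          + p a * ∑ y : Fin n → ι, (∏ k, p (y k)) * ∑ k, g (y k)) := by
          refine Finset.sum_congr rfl fun a _ => ?_
          rw [Finset.mul_sum, Finset.mul_sum, ← Finset.sum_add_distrib]
          refine Finset.sum_congr rfl fun y _ => ?_
          simp only [Fin.prod_univ_succ, Fin.sum_univ_succ, Fin.cons_zero, Fin.cons_succ]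
          ring
      _ = 0 := by simp [h0, ih, hg]

theorem hp_mom2 {ι : Type*} [Fintype ι] (p g : ι → ℝ) (hp : ∑ a, p a = 1)
    (hg : ∑ a, p a * g a = 0) (n : ℕ) :
    ∑ x : Fin n → ι, (∏ k, p (x k)) * (∑ k, g (x k)) ^ 2 = n * ∑ a, p a * g a ^ 2 := by
  induction n with
  | zero => simp
  | succ n ih =>
    rw [hp_sum_cons]
    have h0 := hp_mom0 p hp n
    have h1 := hp_mom1 p g hp hg n
    calc _ = ∑ a, (p a * g a ^ 2 * ∑ y : Fin n → ι, ∏ k, p (y k)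
          + 2 * p a * g a * ∑ y : Fin n → ι, (∏ k, p (y k)) * ∑ k, g (y k)
          + p a * ∑ y : Fin n → ι, (∏ k, p (y k)) * (∑ k, g (y k)) ^ 2) := by
          refine Finset.sum_congr rfl fun a _ => ?_
          rw [Finset.mul_sum, Finset.mul_sum, Finset.mul_sum, ← Finset.sum_add_distrib,
            ← Finset.sum_add_distrib]
          refine Finset.sum_congr rfl fun y _ => ?_
          simp only [Fin.prod_univ_succ, Fin.sum_univ_succ, Fin.cons_zero, Fin.cons_succ]
          ring
      _ = _ := by
          rw [h0, h1, ih, Finset.sum_add_distrib, Finset.sum_add_distrib, ← Finset.sum_mul _ _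
            ((n : ℝ) * _), hp]
          push_cast
          simp
          ring

theorem hp_cheb {ι : Type*} [Fintype ι] (p g : ι → ℝ) (hp0 : ∀ a, 0 ≤ p a)
    (hp : ∑ a, p a = 1) (hg : ∑ a, p a * g a = 0) (n : ℕ) (δ : ℝ) (hδ : 0 < δ) (hn : 0 < n)
    (S : Finset (Fin n → ι))
    (hS : ∀ x ∈ S, 0 < ∏ k, p (x k) → n * δ ≤ |∑ k, g (x k)|) :
    ∑ x ∈ S, ∏ k, p (x k) ≤ (∑ a, p a * g a ^ 2) / (n * δ ^ 2) := by
  have hn' : (0 : ℝ) < n := by exact_mod_cast hn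
  rw [le_div_iff₀ (by positivity)]
  have h2 := hp_mom2 p g hp hg n
  have hw : ∀ x : Fin n → ι, 0 ≤ ∏ k, p (x k) := fun x => Finset.prod_nonneg fun k _ => hp0 _
  have key : ∑ x ∈ S, (∏ k, p (x k)) * (n * δ) ^ 2 ≤ n * ∑ a, p a * g a ^ 2 := by
    rw [← h2]
    refine le_trans (Finset.sum_le_sum fun x hx => ?_)
      (Finset.sum_le_sum_of_subset_of_nonneg (Finset.subset_univ S)
        fun x _ _ => mul_nonneg (hw x) (sq_nonneg _))
    rcases (hw x).eq_or_lt with h | h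
    · rw [← h]; simp
    · refine mul_le_mul_of_nonneg_left ?_ (hw x)
      rw [← sq_abs (∑ k, g (x k))]
      exact pow_le_pow_left₀ (by positivity) (hS x hx h) 2
  rw [← Finset.sum_mul] at key
  have : n * ((∑ x ∈ S, ∏ k, p (x k)) * (n * δ ^ 2)) ≤ n * ∑ a, p a * g a ^ 2 := by
    nlinarith
  exact le_of_mul_le_mul_left this hn'

/-- variance constant -/
def hpV {ι : Type*} [Fintype ι] (p : ι → ℝ) : ℝ :=
  ∑ a, p a * (-Real.log (p a) - -∑ b, p b * Real.log (p b)) ^ 2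

theorem hp_typ {ι : Type*} [Fintype ι] (p : ι → ℝ) (hp0 : ∀ a, 0 ≤ p a)
    (hp : ∑ a, p a = 1) (n : ℕ) (δ : ℝ) (hδ : 0 < δ) (hn : 0 < n)
    (S : Finset (Fin n → ι))
    (hS : ∀ x ∈ S, 0 < ∏ k, p (x k) →
      n * δ ≤ |Real.log (∏ k, p (x k)) + n * -∑ b, p b * Real.log (p b)|) :
    ∑ x ∈ S, ∏ k, p (x k) ≤ hpV p / (n * δ ^ 2) := by
  refine hp_cheb p (fun a => -Real.log (p a) - -∑ b, p b * Real.log (p b)) hp0 hp ?_ n δ hδ hn S ?_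
  · simp only [mul_sub, Finset.sum_sub_distrib, ← Finset.sum_mul, hp]
    simp
  · intro x hx h
    refine (hS x hx h).trans_eq ?_
    rw [Real.log_prod (fun k _ hk => h.ne' (Finset.prod_eq_zero (Finset.mem_univ k) hk)),
      Finset.sum_sub_distrib, ← abs_neg]
    congr 1
    simp
    ring

theorem hp_V_nonneg {ι : Type*} [Fintype ι] (p : ι → ℝ) (hp0 : ∀ a, 0 ≤ p a) : 0 ≤ hpV p :=
  Finset.sum_nonneg fun a _ => mul_nonneg (hp0 a) (sq_nonneg _)

/-! ### Helpers: trace norm -/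

theorem hp_traceNorm_eq {ι : Type*} [Fintype ι] [DecidableEq ι] (ω : Matrix ι ι ℂ) :
    traceNorm ω = ∑ i, Real.sqrt
      ((Matrix.posSemidef_conjTranspose_mul_self ω).1.eigenvalues i) := by
  unfold traceNorm Matrix.PosSemidef.sqrt
  rw [Matrix.trace_mul_cycle]
  simp [Matrix.trace_diagonal]

theorem hp_traceNorm_diag {ι : Type*} [Fintype ι] [DecidableEq ι] (d : ι → ℝ) :
    traceNorm (diagonal fun i => (d i : ℂ)) = ∑ i, |d i| := by
  rw [hp_traceNorm_eq]
  set hH := (Matrix.posSemidef_conjTranspose_mul_self (diagonal fun i => (d i : ℂ))).1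
  have h1 := hH.roots_charpoly_eq_eigenvalues
  have h2 : ((diagonal fun i => (d i : ℂ))ᴴ * diagonal fun i => (d i : ℂ))
      = diagonal fun i => ((d i ^ 2 : ℝ) : ℂ) := by
    rw [diagonal_conjTranspose, diagonal_mul_diagonal]
    congr 1; ext i; simp [sq]
  have h3 : (((diagonal fun i => (d i : ℂ))ᴴ * diagonal fun i => (d i : ℂ)).charpoly).roots
      = Multiset.map (fun i => ((d i ^ 2 : ℝ) : ℂ)) Finset.univ.val := by
    rw [h2]
    generalize (fun i => ((d i ^ 2 : ℝ) : ℂ)) = e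
    rw [charpoly_diagonal, Polynomial.roots_prod]
    · simp
    · simp [Finset.prod_ne_zero_iff, Polynomial.X_sub_C_ne_zero]
  rw [h3] at h1
  have h4 := congrArg (fun m => (Multiset.map (fun z : ℂ => Real.sqrt z.re) m).sum) h1
  simp only [Multiset.map_map, Function.comp_def] at h4
  have h5 : ∑ i, Real.sqrt (d i ^ 2) = ∑ i, Real.sqrt (hH.eigenvalues i) := by
    exact h4
  rw [← h5]
  simp [Real.sqrt_sq_eq_abs]

theorem hp_traceNorm_entry {ι : Type*} [Fintype ι] [DecidableEq ι] (ω : Matrix ι ι ℂ) (i : ι) :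
    ‖ω i i‖ ≤ traceNorm ω := by
  rw [hp_traceNorm_eq]
  set hP := (Matrix.posSemidef_conjTranspose_mul_self ω)
  have h0 : 0 ≤ ∑ i, Real.sqrt (hP.1.eigenvalues i) :=
    Finset.sum_nonneg fun _ _ => Real.sqrt_nonneg _
  refine abs_le_of_sq_le_sq' ?_ h0 |>.2
  have h1 : ∑ i, hP.1.eigenvalues i ≤ (∑ i, Real.sqrt (hP.1.eigenvalues i)) ^ 2 := by
    have := Finset.sum_sq_le_sq_sum_of_nonneg (s := Finset.univ)
      (f := fun i => Real.sqrt (hP.1.eigenvalues i)) (fun _ _ => Real.sqrt_nonneg _)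
    simpa [Real.sq_sqrt (hP.eigenvalues_nonneg _)] using this
  refine le_trans ?_ h1
  have h2 : ((∑ i, hP.1.eigenvalues i : ℝ) : ℂ) = ((∑ j, ∑ k, ‖ω k j‖ ^ 2 : ℝ) : ℂ) := by
    have := hP.1.trace_eq_sum_eigenvalues
    push_cast
    refine this.symm.trans ?_
    simp [Matrix.trace, Matrix.mul_apply, Complex.conj_mul']
  rw [Complex.ofReal_inj.1 h2]
  refine le_trans ?_ (Finset.single_le_sum (f := fun j => ∑ k, ‖ω k j‖ ^ 2)
    (fun j _ => Finset.sum_nonneg fun k _ => sq_nonneg _) (Finset.mem_univ i))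
  exact Finset.single_le_sum (f := fun k => ‖ω k i‖ ^ 2) (fun k _ => sq_nonneg _) (Finset.mem_univ i)

/-! ### Helpers: tensor powers -/

theorem hp_tpow_mul {ι : Type*} [Fintype ι] (A B : Matrix ι ι ℂ) (n : ℕ) :
    tpow (A * B) n = tpow A n * tpow B n := by
  classical
  ext x y
  simp only [tpow, Matrix.mul_apply, Finset.prod_univ_sum, ← Finset.prod_mul_distrib]
  simp

theorem hp_tpow_star {ι : Type*} (A : Matrix ι ι ℂ) (n : ℕ) :
    tpow (Aᴴ) n = (tpow A n)ᴴ := by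
  ext x y
  simp [tpow, Matrix.conjTranspose_apply]

theorem hp_tpow_diag {ι : Type*} [DecidableEq ι] (d : ι → ℂ) (n : ℕ) :
    tpow (diagonal d) n = diagonal fun x => ∏ k, d (x k) := by
  ext x y
  by_cases h : x = y
  · subst h; simp [tpow]
  · rw [diagonal_apply_ne _ h]
    obtain ⟨k, hk⟩ := Function.ne_iff.1 h
    exact Finset.prod_eq_zero (Finset.mem_univ k) (by simp [hk])

theorem hp_tpow_one {ι : Type*} [DecidableEq ι] (n : ℕ) :
    tpow (1 : Matrix ι ι ℂ) n = 1 := by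
  rw [← diagonal_one, hp_tpow_diag]; simp

theorem hp_spec {ι : Type*} [Fintype ι] [DecidableEq ι] (ρ : Matrix ι ι ℂ) (hρ : IsDensity ρ) :
    ∃ (V : Matrix ι ι ℂ) (p : ι → ℝ), Vᴴ * V = 1 ∧ V * Vᴴ = 1 ∧ (∀ a, 0 ≤ p a) ∧ ∑ a, p a = 1 ∧
      entropy ρ = -∑ a, p a * Real.log (p a) ∧ ρ = V * diagonal (fun a => (p a : ℂ)) * Vᴴ := by
  have hH := hρ.1.1
  refine ⟨hH.eigenvectorUnitary, hH.eigenvalues, ?_, ?_, hρ.1.eigenvalues_nonneg, ?_, ?_, ?_⟩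
  · exact Unitary.coe_star_mul_self hH.eigenvectorUnitary
  · exact Unitary.coe_mul_star_self hH.eigenvectorUnitary
  · have h := hH.trace_eq_sum_eigenvalues
    rw [hρ.2] at h
    have h' : ((∑ i, hH.eigenvalues i : ℝ) : ℂ) = ((1 : ℝ) : ℂ) := by
      push_cast; exact h.symm
    exact Complex.ofReal_inj.1 h'
  · simp [entropy, hH]
  · conv_lhs => rw [hH.spectral_theorem]
    rfl

theorem hp_tpow_spec {ι : Type*} [Fintype ι] [DecidableEq ι] {ρ V : Matrix ι ι ℂ} {p : ι → ℝ}
    (hρ : ρ = V * diagonal (fun a => (p a : ℂ)) * Vᴴ) (n : ℕ) :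
    tpow ρ n = tpow V n * diagonal (fun x => ((∏ k, p (x k) : ℝ) : ℂ)) * (tpow V n)ᴴ := by
  rw [hρ, hp_tpow_mul, hp_tpow_mul, hp_tpow_star, hp_tpow_diag]
  simp

theorem hp_conv {ι : Type*} [Fintype ι] [DecidableEq ι] {ρ V : Matrix ι ι ℂ} {p : ι → ℝ}
    (hV1 : Vᴴ * V = 1) (hV2 : V * Vᴴ = 1) (hp0 : ∀ a, 0 ≤ p a) (hp : ∑ a, p a = 1)
    (hρ : ρ = V * diagonal (fun a => (p a : ℂ)) * Vᴴ) (n : ℕ) (hn : 0 < n) (δ : ℝ) (hδ : 0 < δ)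
    (Pr : ConcProtocol ι n)
    (hP : n * (Real.log (Fintype.card ι) - -∑ a, p a * Real.log (p a) + 2 * δ)
      ≤ Real.log Pr.dAp) :
    1 - traceNorm (concOutput ρ Pr - pureZero Pr.dAp) ≤
      Real.exp (-(n * δ)) + hpV p / (n * δ ^ 2) := by
  set H := -∑ a, p a * Real.log (p a) with hH
  obtain ⟨hU1, hU2⟩ := Pr.U_unitary
  set z : Fin Pr.dAp := ⟨0, Pr.dAp_pos⟩
  set w : (Fin n → ι) → ℝ := fun x => ∏ k, p (x k) with hw
  have hw0 : ∀ x, 0 ≤ w x := fun x => Finset.prod_nonneg fun k _ => hp0 _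
  have hw1 : ∑ x, w x = 1 := hp_mom0 p hp n
  set W := Pr.U * tpow V n with hW
  have hT1 : (tpow V n)ᴴ * tpow V n = 1 := by
    rw [← hp_tpow_star, ← hp_tpow_mul, hV1, hp_tpow_one]
  have hT2 : tpow V n * (tpow V n)ᴴ = 1 := by
    rw [← hp_tpow_star, ← hp_tpow_mul, hV2, hp_tpow_one]
  have hW1 : Wᴴ * W = 1 := by
    rw [hW, conjTranspose_mul, Matrix.mul_assoc, ← Matrix.mul_assoc _ Pr.U, hU1, Matrix.one_mul, hT1]
  have hW2 : W * Wᴴ = 1 := by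
    rw [hW, conjTranspose_mul, Matrix.mul_assoc, ← Matrix.mul_assoc _ _ (Pr.Uᴴ), hT2,
      Matrix.one_mul, hU2]
  have hcard : Pr.dAp * Pr.dAg = Fintype.card ι ^ n := by
    have h := Matrix.trace_mul_comm Pr.U Pr.Uᴴ
    rw [hU1, hU2, Matrix.trace_one, Matrix.trace_one] at h
    simpa using (by exact_mod_cast h : Fintype.card (Fin Pr.dAp × Fin Pr.dAg) = Fintype.card (Fin n → ι))
  set c : (Fin n → ι) → ℝ := fun x => ∑ g, ‖W (z, g) x‖ ^ 2 with hc
  have hc0 : ∀ x, 0 ≤ c x := fun x => Finset.sum_nonneg fun g _ => sq_nonneg _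
  have hc1 : ∀ x, c x ≤ 1 := by
    intro x
    have h := congrFun (congrFun hW1 x) x
    rw [Matrix.mul_apply, Matrix.one_apply_eq] at h
    have h' : ((∑ q, ‖W q x‖ ^ 2 : ℝ) : ℂ) = ((1 : ℝ) : ℂ) := by
      push_cast
      rw [← h]
      exact Finset.sum_congr rfl fun q _ => by simp [Complex.conj_mul']
    rw [← Complex.ofReal_inj.1 h', Fintype.sum_prod_type]
    exact Finset.single_le_sum (f := fun a => ∑ g, ‖W (a, g) x‖ ^ 2)
      (fun a _ => Finset.sum_nonneg fun g _ => sq_nonneg _) (Finset.mem_univ z)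
  have hcs : ∑ x, c x = Pr.dAg := by
    rw [hc, Finset.sum_comm]
    have : ∀ g, ∑ x, ‖W (z, g) x‖ ^ 2 = 1 := by
      intro g
      have h := congrFun (congrFun hW2 (z, g)) (z, g)
      rw [Matrix.mul_apply, Matrix.one_apply_eq] at h
      have h' : ((∑ x, ‖W (z, g) x‖ ^ 2 : ℝ) : ℂ) = ((1 : ℝ) : ℂ) := by
        push_cast
        rw [← h]
        exact Finset.sum_congr rfl fun q _ => by simp [Complex.mul_conj']
      exact Complex.ofReal_inj.1 h'
    simp [this]
  have hq : concOutput ρ Pr z z = ((∑ x, c x * w x : ℝ) : ℂ) := by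
    have hst : Pr.U * tpow ρ n * Pr.Uᴴ = W * diagonal (fun x => (w x : ℂ)) * Wᴴ := by
      rw [hp_tpow_spec hρ, hW, conjTranspose_mul]
      simp only [Matrix.mul_assoc]
      rfl
    have hen : ∀ g, (W * diagonal (fun x => (w x : ℂ)) * Wᴴ) (z, g) (z, g) =
        ∑ x, W (z, g) x * (w x : ℂ) * star (W (z, g) x) := by
      intro g
      rw [Matrix.mul_apply]
      refine Finset.sum_congr rfl fun x _ => ?_
      rw [Matrix.mul_diagonal, conjTranspose_apply]
    unfold concOutput ptraceRight
    rw [hst]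
    refine (Finset.sum_congr rfl fun g _ => hen g).trans ?_
    rw [Finset.sum_comm]
    push_cast
    refine Finset.sum_congr rfl fun x _ => ?_
    rw [hc]
    push_cast
    rw [Finset.sum_mul]
    refine Finset.sum_congr rfl fun g _ => ?_
    rw [← Complex.mul_conj']
    simp only [RCLike.star_def]
    ring
  have hent := hp_traceNorm_entry (concOutput ρ Pr - pureZero Pr.dAp) z
  rw [Matrix.sub_apply, hq] at hent
  have hz : pureZero Pr.dAp z z = ((1 : ℝ) : ℂ) := by simp [pureZero, z]
  rw [hz, ← Complex.ofReal_sub, Complex.norm_real, Real.norm_eq_abs] at hent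
  have hent' := (abs_le.1 hent).1
  suffices hs : ∑ x, c x * w x ≤ Real.exp (-(n * δ)) + hpV p / (n * δ ^ 2) by linarith
  have hn' : (0 : ℝ) < n := by exact_mod_cast hn
  classical
  set S : Finset (Fin n → ι) := Finset.univ.filter fun x => Real.exp (-(n * (H - δ))) < w x with hSd
  have hS := hp_typ p hp0 hp n δ hδ hn S (by
    intro x hx hpos
    have hx' := (Finset.mem_filter.1 hx).2
    have := (Real.lt_log_iff_exp_lt hpos).2 hx'
    refine le_trans ?_ (le_abs_self _)
    rw [← hH]
    linarith)
  rw [← Finset.sum_filter_add_sum_filter_not Finset.univ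
    (fun x => Real.exp (-(n * (H - δ))) < w x), add_comm]
  refine add_le_add ?_ (le_trans (Finset.sum_le_sum fun x _ => ?_) hS)
  · calc _ ≤ ∑ x ∈ Finset.univ.filter (fun x => ¬ Real.exp (-(n * (H - δ))) < w x),
          c x * Real.exp (-(n * (H - δ))) := by
          refine Finset.sum_le_sum fun x hx => mul_le_mul_of_nonneg_left ?_ (hc0 x)
          exact not_lt.1 (Finset.mem_filter.1 hx).2
      _ ≤ ∑ x, c x * Real.exp (-(n * (H - δ))) :=
          Finset.sum_le_sum_of_subset_of_nonneg (Finset.subset_univ _)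
            fun x _ _ => mul_nonneg (hc0 x) (Real.exp_pos _).le
      _ = Pr.dAg * Real.exp (-(n * (H - δ))) := by rw [← Finset.sum_mul, hcs]
      _ ≤ Real.exp (n * (H - 2 * δ)) * Real.exp (-(n * (H - δ))) := by
          refine mul_le_mul_of_nonneg_right ?_ (Real.exp_pos _).le
          have hAg : (0 : ℝ) < Pr.dAg := by exact_mod_cast Pr.dAg_pos
          have hAp : (0 : ℝ) < Pr.dAp := by exact_mod_cast Pr.dAp_pos
          rw [← Real.log_le_iff_le_exp hAg]
          have h1 : Real.log Pr.dAp + Real.log Pr.dAg = n * Real.log (Fintype.card ι) := by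
            rw [← Real.log_mul hAp.ne' hAg.ne', ← Real.log_pow]
            congr 1
            exact_mod_cast hcard
          linarith
      _ = Real.exp (-(n * δ)) := by
          rw [← Real.exp_add]; congr 1; ring
  · exact mul_le_of_le_one_left (hw0 x) (hc1 x)

theorem hp_ach {ι : Type*} [Fintype ι] [DecidableEq ι] {ρ V : Matrix ι ι ℂ} {p : ι → ℝ}
    (hV1 : Vᴴ * V = 1) (hV2 : V * Vᴴ = 1) (hp0 : ∀ a, 0 ≤ p a) (hp : ∑ a, p a = 1)
    (hρ : ρ = V * diagonal (fun a => (p a : ℂ)) * Vᴴ) (n : ℕ) (hn : 0 < n) (δ : ℝ) (hδ : 0 < δ) :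
    ∃ Pr : ConcProtocol ι n,
      n * (Real.log (Fintype.card ι) - -∑ a, p a * Real.log (p a) - δ)
        - Real.log (Fintype.card ι) ≤ Real.log Pr.dAp ∧
      traceNorm (concOutput ρ Pr - pureZero Pr.dAp) ≤ 2 * (hpV p / (n * δ ^ 2)) := by
  set H := -∑ a, p a * Real.log (p a) with hH
  set w : (Fin n → ι) → ℝ := fun x => ∏ k, p (x k) with hw
  have hw0 : ∀ x, 0 ≤ w x := fun x => Finset.prod_nonneg fun k _ => hp0 _
  have hw1 : ∑ x, w x = 1 := hp_mom0 p hp n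
  have hn' : (0 : ℝ) < n := by exact_mod_cast hn
  have hne : Nonempty ι := by
    by_contra h
    rw [not_nonempty_iff] at h
    simp at hp
  set d := Fintype.card ι with hd
  have hdpos : 0 < d := Fintype.card_pos
  have hd1 : (1 : ℝ) ≤ d := by exact_mod_cast hdpos
  have hld : 0 ≤ Real.log d := Real.log_nonneg hd1
  have hH0 : 0 ≤ H := by
    rw [hH, ← Finset.sum_neg_distrib]
    refine Finset.sum_nonneg fun a _ => ?_
    have ha : p a ≤ 1 := hp ▸ Finset.single_le_sum (f := p) (fun b _ => hp0 b) (Finset.mem_univ a)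
    have := Real.log_nonpos (hp0 a) ha
    nlinarith [hp0 a]
  classical
  set T : Finset (Fin n → ι) := Finset.univ.filter fun x => Real.exp (-(n * (H + δ))) ≤ w x with hTd
  have hTc := hp_typ p hp0 hp n δ hδ hn Tᶜ (by
    intro x hx hpos
    have hx' : w x < Real.exp (-(n * (H + δ))) := by
      simpa [hTd] using hx
    have := (Real.log_lt_iff_lt_exp hpos).2 hx'
    refine le_trans ?_ (neg_le_abs _)
    rw [← hH]
    linarith)
  have hTcard : (T.card : ℝ) ≤ Real.exp (n * (H + δ)) := by
    have h1 : (T.card : ℝ) * Real.exp (-(n * (H + δ))) ≤ 1 := by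
      rw [← hw1, ← nsmul_eq_mul]
      refine le_trans (Finset.card_nsmul_le_sum T w _ fun x hx => (Finset.mem_filter.1 hx).2)
        (Finset.sum_le_sum_of_subset_of_nonneg (Finset.subset_univ _) fun x _ _ => hw0 x)
    rw [Real.exp_neg, ← div_eq_mul_inv, div_le_one (Real.exp_pos _)] at h1
    exact h1
  have hex : ∃ m, T.card ≤ d ^ m := ⟨n, by
    refine (Finset.card_le_univ T).trans ?_
    simp [hd]⟩
  obtain ⟨m, hm, hmn, hml⟩ : ∃ m, T.card ≤ d ^ m ∧ m ≤ n ∧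
      m * Real.log d ≤ n * (H + δ) + Real.log d := by
    refine ⟨Nat.find hex, Nat.find_spec hex, Nat.find_min' hex ?_, ?_⟩
    · refine (Finset.card_le_univ T).trans ?_
      simp [hd]
    · rcases Nat.eq_zero_or_pos (Nat.find hex) with h | h
      · rw [h, Nat.cast_zero, zero_mul]; positivity
      · have h1 := Nat.find_min hex (Nat.sub_lt h one_pos)
        rw [not_le] at h1
        have h2 : ((d : ℝ) ^ (Nat.find hex - 1)) ≤ Real.exp (n * (H + δ)) :=
          le_trans (by exact_mod_cast h1.le) hTcard
        rw [← Real.log_le_iff_le_exp (by positivity), Real.log_pow, Nat.cast_sub h] at h2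
        push_cast at h2
        linarith
  have hAp : 0 < d ^ (n - m) := by positivity
  have hAg : 0 < d ^ m := by positivity
  set z : Fin (d ^ (n - m)) := ⟨0, hAp⟩ with hz
  obtain ⟨e, he⟩ : ∃ e : (Fin n → ι) ≃ Fin (d ^ (n - m)) × Fin (d ^ m),
      ∀ x ∈ T, (e x).1 = z := by
    have hc1 : Fintype.card (Fin n → ι) =
        (Finset.univ : Finset (Fin (d ^ (n - m)) × Fin (d ^ m))).card := by
      rw [Finset.card_univ]
      simp only [Fintype.card_prod, Fintype.card_fin, Fintype.card_pi_const]
      rw [← pow_add, Nat.sub_add_cancel hmn]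
    obtain ⟨f⟩ : Nonempty (T ↪ Fin (d ^ m)) :=
      Function.Embedding.nonempty_of_card_le (by simpa using hm)
    set F : (Fin n → ι) → Fin (d ^ (n - m)) × Fin (d ^ m) := fun x =>
      (z, if h : x ∈ T then f ⟨x, h⟩ else ⟨0, hAg⟩) with hF
    obtain ⟨g, hg⟩ := Finset.exists_equiv_extend_of_card_eq hc1 (s := T) (f := F)
      (Finset.subset_univ _) (by
        intro x hx y hy hxy
        have hx' : x ∈ T := hx
        have hy' : y ∈ T := hy
        simp only [hF, hx', hy', dif_pos, Prod.mk.injEq, true_and] at hxy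
        exact congrArg Subtype.val (f.injective hxy))
    refine ⟨g.trans (Equiv.subtypeUnivEquiv fun x => Finset.mem_univ x), fun x hx => ?_⟩
    have := hg x hx
    simp [Equiv.subtypeUnivEquiv, this, hF]
  have hT1 : (tpow V n)ᴴ * tpow V n = 1 := by
    rw [← hp_tpow_star, ← hp_tpow_mul, hV1, hp_tpow_one]
  have hT2 : tpow V n * (tpow V n)ᴴ = 1 := by
    rw [← hp_tpow_star, ← hp_tpow_mul, hV2, hp_tpow_one]
  refine ⟨⟨d ^ (n - m), d ^ m, hAp, hAg, ((tpow V n)ᴴ).submatrix e.symm id, ?_, ?_⟩, ?_, ?_⟩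
  · rw [conjTranspose_submatrix, conjTranspose_conjTranspose, submatrix_mul_equiv, hT2]
    simp
  · rw [conjTranspose_submatrix, conjTranspose_conjTranspose,
      ← submatrix_mul _ _ _ id _ Function.bijective_id, hT1]
    simp
  · simp only
    push_cast
    rw [Real.log_pow, Nat.cast_sub hmn]
    linarith
  · set q : Fin (d ^ (n - m)) → ℝ := fun a => ∑ g, w (e.symm (a, g)) with hq
    have hq0 : ∀ a, 0 ≤ q a := fun a => Finset.sum_nonneg fun g _ => hw0 _
    have hq1 : ∑ a, q a = 1 := by
      rw [hq, ← Fintype.sum_prod_type', ← hw1]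
      exact Fintype.sum_equiv e.symm _ _ fun _ => rfl
    have hqz : 1 - q z ≤ hpV p / (n * δ ^ 2) := by
      refine le_trans ?_ hTc
      have h1 : ∑ x ∈ T, w x ≤ q z := by
        have : q z = ∑ x ∈ Finset.univ.filter (fun x => (e x).1 = z), w x := by
          rw [Finset.sum_filter, ← Equiv.sum_comp e.symm, Fintype.sum_prod_type]
          simp only [Equiv.apply_symm_apply]
          rw [Finset.sum_eq_single z]
          · simp [hq]
          · intro b _ hb; simp [hb]
          · simp
        rw [this]
        refine Finset.sum_le_sum_of_subset_of_nonneg (fun x hx => ?_) fun x _ _ => hw0 x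
        exact Finset.mem_filter.2 ⟨Finset.mem_univ _, he x hx⟩
      have h2 := Finset.sum_add_sum_compl T w
      rw [hw1] at h2
      show _ ≤ ∑ x ∈ Tᶜ, w x
      linarith
    have hout : ptraceRight (((tpow V n)ᴴ).submatrix e.symm id * tpow ρ n *
        (((tpow V n)ᴴ).submatrix e.symm id)ᴴ) - pureZero (d ^ (n - m)) =
        diagonal fun a => ((q a - if a = z then 1 else 0 : ℝ) : ℂ) := by
      have h1 : ((tpow V n)ᴴ).submatrix e.symm id * tpow ρ n *
          (((tpow V n)ᴴ).submatrix e.symm id)ᴴ =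
          diagonal fun y => (w (e.symm y) : ℂ) := by
        have h2 : (tpow V n)ᴴ * tpow ρ n * tpow V n = diagonal fun x => (w x : ℂ) := by
          rw [hp_tpow_spec hρ]
          simp only [← Matrix.mul_assoc]
          rw [hT1, Matrix.one_mul, Matrix.mul_assoc, hT1, Matrix.mul_one]
        rw [conjTranspose_submatrix, conjTranspose_conjTranspose]
        conv_lhs => rw [← submatrix_id_id (tpow ρ n)]
        rw [← submatrix_mul _ _ _ id _ Function.bijective_id,
          ← submatrix_mul _ _ _ id _ Function.bijective_id, h2,
          submatrix_diagonal_equiv]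
        rfl
      rw [h1]
      ext a b
      have hzv : ∀ c : Fin (d ^ (n - m)), c.val = 0 ↔ c = z := fun c => by
        rw [hz, Fin.ext_iff]
      by_cases hab : a = b
      · subst hab
        by_cases haz : a = z <;> simp [ptraceRight, pureZero, hzv, hq, haz]
      · have : ¬ (a = z ∧ b = z) := fun h => hab (h.1.trans h.2.symm)
        simp [ptraceRight, pureZero, hzv, hab, this]
    show traceNorm (ptraceRight (((tpow V n)ᴴ).submatrix e.symm id * tpow ρ n *
        (((tpow V n)ᴴ).submatrix e.symm id)ᴴ) - pureZero (d ^ (n - m))) ≤ _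
    rw [hout, hp_traceNorm_diag]
    have hqle : q z ≤ 1 := hq1 ▸ Finset.single_le_sum (fun b _ => hq0 b) (Finset.mem_univ z)
    have hsum : ∑ a, |q a - if a = z then 1 else 0| = 2 * (1 - q z) := by
      have hterm : ∀ a, |q a - if a = z then 1 else 0| =
          q a + if a = z then (1 - 2 * q z) else 0 := by
        intro a
        by_cases h : a = z
        · subst h; simp only [if_true]; rw [abs_of_nonpos (by linarith)]; ring
        · simp [h, abs_of_nonneg (hq0 a)]
      simp only [hterm, Finset.sum_add_distrib, hq1]
      simp
      ring
    rw [hsum]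
    linarith

/-- **Purity concentration (Lemma 1).** The purity of a state `ρ^A` on a system of
dimension `d_A` is `κ(ρ^A) = log d_A - H(A)_ρ`. -/
theorem purity_concentration {α : Type*} [Fintype α] [DecidableEq α]
    (ρ : Matrix α α ℂ) (hρ : IsDensity ρ) :
    kappaConc ρ = Real.log (Fintype.card α) - entropy ρ := by
  obtain ⟨V, p, hV1, hV2, hp0, hp, hent, hsp⟩ := hp_spec ρ hρ
  rw [hent]
  have hV0 := hp_V_nonneg p hp0
  have hach : ConcAchievable ρ (Real.log (Fintype.card α) - -∑ a, p a * Real.log (p a)) := by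
    intro ε hε δ hδ
    have hnat : Tendsto (fun n : ℕ => (n : ℝ)) atTop atTop := tendsto_natCast_atTop_atTop
    have ht1 : Tendsto (fun n : ℕ => Real.log (Fintype.card α) / (n : ℝ)) atTop (nhds 0) :=
      hnat.const_div_atTop _
    have ht2 : Tendsto (fun n : ℕ => hpV p / ((n : ℝ) * (δ / 2) ^ 2)) atTop (nhds 0) :=
      (hnat.atTop_mul_const (by positivity)).const_div_atTop _
    obtain ⟨N, hN⟩ := eventually_atTop.1
      ((ht1.eventually_lt_const (show (0:ℝ) < δ / 2 by linarith)).and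
      ((ht2.eventually_lt_const (show (0:ℝ) < ε / 2 by linarith)).and
      (eventually_gt_atTop 0)))
    refine ⟨N, fun n hn => ?_⟩
    obtain ⟨h1, h2, h3⟩ := hN n hn
    obtain ⟨Pr, hr, herr⟩ := hp_ach hV1 hV2 hp0 hp hsp n h3 (δ / 2) (by linarith)
    have hn' : (0 : ℝ) < n := by exact_mod_cast h3
    refine ⟨Pr, ?_, by linarith⟩
    rw [le_div_iff₀ hn']
    rw [div_lt_iff₀ hn'] at h1
    linarith
  refine IsLUB.csSup_eq ⟨?_, fun b hb => hb hach⟩ ⟨_, hach⟩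
  · intro P hP
    by_contra hlt
    rw [not_le] at hlt
    set κ := Real.log (Fintype.card α) - -∑ a, p a * Real.log (p a) with hκ
    obtain ⟨δ, hδ, hδP⟩ : ∃ δ > 0, κ + 3 * δ = P := ⟨(P - κ) / 3, by linarith, by ring⟩
    obtain ⟨N, hN⟩ := hP (1 / 4) (by norm_num) δ hδ
    have hnat : Tendsto (fun n : ℕ => (n : ℝ)) atTop atTop := tendsto_natCast_atTop_atTop
    have ht1 : Tendsto (fun n : ℕ => Real.exp (-((n : ℝ) * δ))) atTop (nhds 0) :=
      Real.tendsto_exp_neg_atTop_nhds_zero.comp (hnat.atTop_mul_const hδ)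
    have ht2 : Tendsto (fun n : ℕ => hpV p / ((n : ℝ) * δ ^ 2)) atTop (nhds 0) :=
      (hnat.atTop_mul_const (by positivity)).const_div_atTop _
    obtain ⟨n, h1, h2, h3, h4⟩ := ((ht1.eventually_lt_const (show (0:ℝ) < 1/4 by norm_num)).and
      ((ht2.eventually_lt_const (show (0:ℝ) < 1/4 by norm_num)).and
      ((eventually_ge_atTop N).and (eventually_gt_atTop 0)))).exists
    obtain ⟨Pr, hr, herr⟩ := hN n h3
    have hn' : (0 : ℝ) < n := by exact_mod_cast h4
    rw [le_div_iff₀ hn'] at hr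
    have := hp_conv hV1 hV2 hp0 hp hsp n h4 δ hδ Pr (by
      rw [← hκ]
      refine le_trans (le_of_eq ?_) hr
      rw [← hδP]; ring)
    linarith

end LPD
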